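/- Let a ≥ 0 and b > 0 be real numbers (with the convention 1/Γ(0) = 0 when a = 0), and let p > 0 be a real number with a/(b+1) < p² < (a+1)/b. For each positive integer N set L_N = a·N, n_N = (b+1)·N, δ_N = (n_N + L_N + 1)/(N·(1+p²)²). Fix a real number χ and set λ_N = p + χ/√(N·δ_N). Then lim_{N→∞} (1/N) · ĝ_N^{(n_N,L_N)}(λ_N²) · λ_N^{2L_N} · (1+λ_N²)^{−(n_N+L_N+1)} = (a + 1 − b·p²)/(1+p²), where all powers with real exponents are real powers. -/

import Mathlib

open Finset Filter

noncomputable section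

/-- `q_N^{(n,L)}(y)`. -/
def qS (n L : ℝ) (N : ℕ) (y : ℝ) : ℝ :=
  ∑ k ∈ Finset.range (N + 1),
    Real.Gamma (L + n + 1) / (Real.Gamma ((k : ℝ) + L + 1) * Real.Gamma (n + 1 - k)) * y ^ k

/-- `q̂_N^{(n,L)}(y|x)`. -/
def qhat (n L : ℝ) (N : ℕ) (y x : ℝ) : ℝ :=
  qS n L N y + (1 / (n * x - L)) * (Real.Gamma (L + n + 1) / (Real.Gamma (n + 1) * Real.Gamma L))

/-- `ĝ_N^{(n,L)}(x)`. -/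
def ghat (n L : ℝ) (N : ℕ) (x : ℝ) : ℝ :=
  (L + (N : ℝ) + 1) * qhat n L (N + 1) x x - x * (n - N - 1) * qhat n L N x x

/-- The unnormalised density of the beta distribution. -/
def betaKernel (α β t : ℝ) : ℝ := t ^ (α - 1) * (1 - t) ^ (β - 1)

/-- The upper tail `P(X > u)` of a beta random variable `X` with parameters `α`, `β`.
It vanishes for `α = 0`, since `Real.Gamma 0 = 0`. -/
def betaTail (α β u : ℝ) : ℝ :=
  Real.Gamma (α + β) / (Real.Gamma α * Real.Gamma β) * ∫ t in u..1, betaKernel α β t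

lemma betaKernel_nonneg {α β t : ℝ} (h0 : 0 ≤ t) (h1 : t ≤ 1) : 0 ≤ betaKernel α β t :=
  mul_nonneg (Real.rpow_nonneg h0 _) (Real.rpow_nonneg (by linarith) _)

lemma betaKernel_intervalIntegrable {α β : ℝ} (hα : 0 < α) (hβ : 1 ≤ β) (x y : ℝ) :
    IntervalIntegrable (betaKernel α β) MeasureTheory.volume x y := by
  refine (intervalIntegral.intervalIntegrable_rpow' (by linarith)).mul_continuousOn ?_
  refine ContinuousOn.rpow_const (by fun_prop) ?_
  intro t _
  right; linarith

lemma integral_betaKernel {α β : ℝ} (hα : 0 < α) (hβ : 0 < β) :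
    ∫ t in (0 : ℝ)..1, betaKernel α β t =
      Real.Gamma α * Real.Gamma β / Real.Gamma (α + β) := by
  change _ = ProbabilityTheory.beta α β
  rw [ProbabilityTheory.beta_eq_betaIntegralReal α β hα hβ, Complex.betaIntegral]
  have : ∀ t ∈ Set.uIcc (0 : ℝ) 1,
      (t : ℂ) ^ ((α : ℂ) - 1) * (1 - (t : ℂ)) ^ ((β : ℂ) - 1) = ((betaKernel α β t : ℝ) : ℂ) := by
    intro t ht
    rw [Set.uIcc_of_le zero_le_one] at ht
    have h1 : 0 ≤ 1 - t := by linarith [ht.2]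
    rw [betaKernel, Complex.ofReal_mul, Complex.ofReal_cpow ht.1, Complex.ofReal_cpow h1]
    push_cast
    rfl
  rw [intervalIntegral.integral_congr this, intervalIntegral.integral_ofReal, Complex.ofReal_re]

lemma betaKernel_add_one {α β t : ℝ} (hα : 0 < α) (ht : 0 ≤ t) :
    betaKernel (α + 1) β t = t * betaKernel α β t := by
  have : t ^ (α + 1 - 1) = t ^ (α - 1) * t := by
    rw [← Real.rpow_add_one' ht (by linarith)]; ring_nf
  rw [betaKernel, betaKernel, this]; ring

lemma integral_sq_sub_mul_betaKernel {α β : ℝ} (hα : 0 < α) (hβ : 1 ≤ β) :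
    ∫ t in (0 : ℝ)..1, (t - α / (α + β)) ^ 2 * betaKernel α β t =
      α * β / ((α + β) ^ 2 * (α + β + 1)) *
        (Real.Gamma α * Real.Gamma β / Real.Gamma (α + β)) := by
  set m := α / (α + β) with hm
  have h : ∀ t ∈ Set.uIcc (0 : ℝ) 1, (t - m) ^ 2 * betaKernel α β t =
      (betaKernel (α + 1 + 1) β t - 2 * m * betaKernel (α + 1) β t) +
        m ^ 2 * betaKernel α β t := by
    intro t ht
    rw [Set.uIcc_of_le zero_le_one] at ht
    rw [betaKernel_add_one (by linarith) ht.1, betaKernel_add_one hα ht.1]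
    ring
  have hi0 := betaKernel_intervalIntegrable hα hβ 0 1
  have hi1 := betaKernel_intervalIntegrable (α := α + 1) (by linarith) hβ 0 1
  have hi2 := betaKernel_intervalIntegrable (α := α + 1 + 1) (by linarith) hβ 0 1
  have hβ0 : 0 < β := by linarith
  rw [intervalIntegral.integral_congr h,
    intervalIntegral.integral_add (hi2.sub (hi1.const_mul _)) (hi0.const_mul _),
    intervalIntegral.integral_sub hi2 (hi1.const_mul _),
    intervalIntegral.integral_const_mul, intervalIntegral.integral_const_mul,
    integral_betaKernel hα hβ0, integral_betaKernel (by linarith) hβ0,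
    integral_betaKernel (by linarith) hβ0]
  have e1 : α + 1 + β = (α + β) + 1 := by ring
  have e2 : α + 1 + 1 + β = (α + β) + 1 + 1 := by ring
  have hs : 0 < α + β := by linarith
  rw [e1, e2, Real.Gamma_add_one (s := α + 1) (by linarith), Real.Gamma_add_one hα.ne',
    Real.Gamma_add_one (s := α + β + 1) (by linarith), Real.Gamma_add_one hs.ne', hm]
  have hG : Real.Gamma (α + β) ≠ 0 := (Real.Gamma_pos_of_pos hs).ne'
  have hs1 : α + β + 1 ≠ 0 := by linarith
  field_simp
  ring

lemma integral_sq_sub_mul_betaKernel_le {α β : ℝ} (hα : 0 < α) (hβ : 1 ≤ β) :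
    ∫ t in (0 : ℝ)..1, (t - α / (α + β)) ^ 2 * betaKernel α β t ≤
      1 / (α + β) * (Real.Gamma α * Real.Gamma β / Real.Gamma (α + β)) := by
  rw [integral_sq_sub_mul_betaKernel hα hβ]
  have hβ0 : 0 < β := by linarith
  have hs : 0 < α + β := by linarith
  have hG := Real.Gamma_pos_of_pos hs
  have hG1 := Real.Gamma_pos_of_pos hα
  have hG2 := Real.Gamma_pos_of_pos hβ0
  refine mul_le_mul_of_nonneg_right ?_ (by positivity)
  rw [div_le_div_iff₀ (by positivity) hs]
  nlinarith [mul_pos hα hβ0, mul_pos hs hs, mul_pos hs (mul_pos hs hs),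
    mul_pos hs (mul_pos hα hβ0), mul_pos hs (mul_pos hα hα), mul_pos hs (mul_pos hβ0 hβ0)]

lemma mul_integral_betaKernel_le {α β x y d : ℝ} (hα : 0 < α) (hβ : 1 ≤ β)
    (hx : 0 ≤ x) (hxy : x ≤ y) (hy : y ≤ 1)
    (hd : ∀ t ∈ Set.Icc x y, d ≤ (t - α / (α + β)) ^ 2) :
    d * ∫ t in x..y, betaKernel α β t ≤
      1 / (α + β) * (Real.Gamma α * Real.Gamma β / Real.Gamma (α + β)) := by
  refine le_trans ?_ (integral_sq_sub_mul_betaKernel_le hα hβ)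
  have hi : ∀ x y, IntervalIntegrable (fun t => (t - α / (α + β)) ^ 2 * betaKernel α β t)
      MeasureTheory.volume x y := fun x y =>
    (betaKernel_intervalIntegrable hα hβ x y).continuousOn_mul (by fun_prop)
  calc d * ∫ t in x..y, betaKernel α β t
      = ∫ t in x..y, d * betaKernel α β t := (intervalIntegral.integral_const_mul _ _).symm
    _ ≤ ∫ t in x..y, (t - α / (α + β)) ^ 2 * betaKernel α β t :=
        intervalIntegral.integral_mono_on hxy
          ((betaKernel_intervalIntegrable hα hβ x y).const_mul d) (hi x y)
          fun t ht => mul_le_mul_of_nonneg_right (hd t ht)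
            (betaKernel_nonneg (hx.trans ht.1) (ht.2.trans hy))
    _ ≤ _ := by
        refine intervalIntegral.integral_mono_interval hx hxy hy ?_ (hi 0 1)
        filter_upwards [MeasureTheory.ae_restrict_mem measurableSet_Ioc] with t ht
        exact mul_nonneg (sq_nonneg _) (betaKernel_nonneg ht.1.le ht.2)

lemma betaTail_nonneg {α β u : ℝ} (hα : 0 ≤ α) (hβ : 0 ≤ β) (hu : 0 ≤ u) (hu1 : u ≤ 1) :
    0 ≤ betaTail α β u :=
  mul_nonneg (div_nonneg (Real.Gamma_nonneg_of_nonneg (add_nonneg hα hβ))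
      (mul_nonneg (Real.Gamma_nonneg_of_nonneg hα) (Real.Gamma_nonneg_of_nonneg hβ)))
    (intervalIntegral.integral_nonneg hu1 fun _ ht =>
      betaKernel_nonneg (hu.trans ht.1) ht.2)

lemma betaTail_zero_left (β u : ℝ) : betaTail 0 β u = 0 := by
  simp [betaTail, Real.Gamma_zero]

lemma betaTail_eq_one_sub {α β : ℝ} (hα : 0 < α) (hβ : 1 ≤ β) (u : ℝ) :
    betaTail α β u = 1 - Real.Gamma (α + β) / (Real.Gamma α * Real.Gamma β) *
      ∫ t in (0 : ℝ)..u, betaKernel α β t := by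
  have hβ0 : 0 < β := by linarith
  have hG := Real.Gamma_pos_of_pos (add_pos hα hβ0)
  have hG1 := Real.Gamma_pos_of_pos hα
  have hG2 := Real.Gamma_pos_of_pos hβ0
  have h := intervalIntegral.integral_add_adjacent_intervals
    (betaKernel_intervalIntegrable hα hβ 0 u) (betaKernel_intervalIntegrable hα hβ u 1)
  rw [integral_betaKernel hα hβ0] at h
  rw [betaTail, eq_sub_of_add_eq' h]
  field_simp

/-- Chebyshev's inequality for the beta distribution, right of the mean. -/
lemma betaTail_le {α β u : ℝ} (hα : 0 ≤ α) (hβ : 1 ≤ β) (hu : α / (α + β) < u) (hu1 : u ≤ 1) :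
    betaTail α β u ≤ 1 / ((α + β) * (u - α / (α + β)) ^ 2) := by
  have hβ0 : 0 < β := by linarith
  have hs : 0 < α + β := by linarith
  have hm : 0 ≤ α / (α + β) := by positivity
  have hd : 0 < u - α / (α + β) := by linarith
  rcases hα.eq_or_lt with rfl | hα
  · rw [betaTail_zero_left]; positivity
  have hG := Real.Gamma_pos_of_pos hs
  have hG1 := Real.Gamma_pos_of_pos hα
  have hG2 := Real.Gamma_pos_of_pos hβ0
  have h := mul_integral_betaKernel_le (d := (u - α / (α + β)) ^ 2) hα hβ (by linarith) hu1 le_rfl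
    (fun t ht => by have := ht.1; gcongr)
  rw [betaTail, le_div_iff₀ (by positivity)]
  calc _ = (α + β) * (Real.Gamma (α + β) / (Real.Gamma α * Real.Gamma β)) *
        ((u - α / (α + β)) ^ 2 * ∫ t in u..1, betaKernel α β t) := by ring
    _ ≤ (α + β) * (Real.Gamma (α + β) / (Real.Gamma α * Real.Gamma β)) *
        (1 / (α + β) * (Real.Gamma α * Real.Gamma β / Real.Gamma (α + β))) := by gcongr
    _ = 1 := by field_simp

/-- Chebyshev's inequality for the beta distribution, left of the mean. -/
lemma one_sub_betaTail_le {α β u : ℝ} (hα : 0 < α) (hβ : 1 ≤ β) (hu0 : 0 ≤ u)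
    (hu : u < α / (α + β)) :
    1 - betaTail α β u ≤ 1 / ((α + β) * (α / (α + β) - u) ^ 2) := by
  have hβ0 : 0 < β := by linarith
  have hs : 0 < α + β := by linarith
  have hm : α / (α + β) ≤ 1 := by rw [div_le_one hs]; linarith
  have hd : 0 < α / (α + β) - u := by linarith
  have hG := Real.Gamma_pos_of_pos hs
  have hG1 := Real.Gamma_pos_of_pos hα
  have hG2 := Real.Gamma_pos_of_pos hβ0
  have h := mul_integral_betaKernel_le (d := (α / (α + β) - u) ^ 2) hα hβ le_rfl hu0
    (by linarith)
    (fun t ht => by have := ht.2; nlinarith)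
  rw [betaTail_eq_one_sub hα hβ, sub_sub_cancel, le_div_iff₀ (by positivity)]
  calc _ = (α + β) * (Real.Gamma (α + β) / (Real.Gamma α * Real.Gamma β)) *
        ((α / (α + β) - u) ^ 2 * ∫ t in 0..u, betaKernel α β t) := by ring
    _ ≤ (α + β) * (Real.Gamma (α + β) / (Real.Gamma α * Real.Gamma β)) *
        (1 / (α + β) * (Real.Gamma α * Real.Gamma β / Real.Gamma (α + β))) := by gcongr
    _ = 1 := by field_simp

lemma betaTail_le_one {α β u : ℝ} (hα : 0 < α) (hβ : 1 ≤ β) (hu0 : 0 ≤ u) (hu1 : u ≤ 1) :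
    betaTail α β u ≤ 1 := by
  have hβ0 : 0 < β := by linarith
  rw [betaTail_eq_one_sub hα hβ, sub_le_self_iff]
  exact mul_nonneg (div_nonneg (Real.Gamma_pos_of_pos (by linarith)).le
      (mul_pos (Real.Gamma_pos_of_pos hα) (Real.Gamma_pos_of_pos hβ0)).le)
    (intervalIntegral.integral_nonneg hu0 fun _ ht => betaKernel_nonneg ht.1 (ht.2.trans hu1))

lemma tendsto_inv_mul_sq_zero {s d : ℕ → ℝ} {c : ℝ} (hs : Tendsto s atTop atTop)
    (hd : Tendsto d atTop (nhds c)) (hc : c ≠ 0) :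
    Tendsto (fun N => 1 / (s N * d N ^ 2)) atTop (nhds 0) := by
  simp only [one_div]
  exact (hs.atTop_mul_pos (by positivity) (hd.pow 2)).inv_tendsto_atTop

lemma tendsto_betaTail_zero {α β u : ℕ → ℝ} {m v : ℝ}
    (hα : ∀ᶠ N in atTop, 0 ≤ α N) (hβ : ∀ᶠ N in atTop, 1 ≤ β N)
    (hs : Tendsto (fun N => α N + β N) atTop atTop)
    (hm : Tendsto (fun N => α N / (α N + β N)) atTop (nhds m))
    (hu : Tendsto u atTop (nhds v)) (hv0 : 0 < v) (hv1 : v < 1) (hmv : m < v) :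
    Tendsto (fun N => betaTail (α N) (β N) (u N)) atTop (nhds 0) := by
  refine tendsto_of_tendsto_of_tendsto_of_le_of_le' tendsto_const_nhds
    (tendsto_inv_mul_sq_zero hs (hu.sub hm) (sub_pos.2 hmv).ne') ?_ ?_
  · filter_upwards [hα, hβ, hu.eventually_lt_const hv1, hu.eventually_const_lt hv0]
      with N h1 h2 h3 h4
    exact betaTail_nonneg h1 (by linarith) h4.le h3.le
  · filter_upwards [hα, hβ, hu.eventually_lt_const hv1, hm.eventually_lt hu hmv] with N h1 h2 h3 h4
    exact betaTail_le h1 h2 h4 h3.le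

lemma tendsto_betaTail_one {α β u : ℕ → ℝ} {m v : ℝ}
    (hα : ∀ᶠ N in atTop, 0 < α N) (hβ : ∀ᶠ N in atTop, 1 ≤ β N)
    (hs : Tendsto (fun N => α N + β N) atTop atTop)
    (hm : Tendsto (fun N => α N / (α N + β N)) atTop (nhds m))
    (hu : Tendsto u atTop (nhds v)) (hv0 : 0 < v) (hv1 : v < 1) (hmv : v < m) :
    Tendsto (fun N => betaTail (α N) (β N) (u N)) atTop (nhds 1) := by
  have hb := (tendsto_inv_mul_sq_zero hs (hm.sub hu) (sub_pos.2 hmv).ne').const_sub 1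
  rw [sub_zero] at hb
  refine tendsto_of_tendsto_of_tendsto_of_le_of_le' hb tendsto_const_nhds ?_ ?_
  · filter_upwards [hα, hβ, hu.eventually_const_lt hv0, hu.eventually_lt hm hmv] with N h1 h2 h3 h4
    linarith [one_sub_betaTail_le h1 h2 h3.le h4]
  · filter_upwards [hα, hβ, hu.eventually_lt_const hv1, hu.eventually_const_lt hv0]
      with N h1 h2 h3 h4
    exact betaTail_le_one h1 h2 h4.le h3.le

/-- Integration by parts: consecutive beta tails differ by a binomial-type term. -/
lemma betaTail_succ_sub {α β u : ℝ} (hα : 0 ≤ α) (hβ : 1 ≤ β) (hu0 : 0 < u) (hu1 : u < 1) :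
    betaTail (α + 1) β u - betaTail α (β + 1) u =
      Real.Gamma (α + β + 1) / (Real.Gamma (α + 1) * Real.Gamma (β + 1)) *
        (u ^ α * (1 - u) ^ β) := by
  have hpos : ∀ t ∈ Set.uIcc u 1, 0 < t := fun t ht => by
    rw [Set.uIcc_of_le hu1.le] at ht; exact hu0.trans_le ht.1
  have hderiv : ∀ t ∈ Set.uIcc u 1, HasDerivAt (fun t : ℝ => t ^ α * (1 - t) ^ β)
      (α * betaKernel α (β + 1) t - β * betaKernel (α + 1) β t) t := by
    intro t ht
    have h1 : HasDerivAt (fun t : ℝ => t ^ α) (α * t ^ (α - 1)) t :=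
      Real.hasDerivAt_rpow_const (Or.inl (hpos t ht).ne')
    have h2 : HasDerivAt (fun t : ℝ => (1 - t) ^ β) (-1 * β * (1 - t) ^ (β - 1)) t :=
      ((hasDerivAt_id t).const_sub 1).rpow_const (Or.inr hβ)
    refine (h1.mul h2).congr_deriv ?_
    simp only [betaKernel, add_sub_cancel_right]
    ring
  have hc : ∀ α β : ℝ, 1 ≤ β →
      IntervalIntegrable (betaKernel α β) MeasureTheory.volume u 1 := by
    intro α β hβ
    refine ContinuousOn.intervalIntegrable fun t ht => ContinuousAt.continuousWithinAt ?_
    refine ContinuousAt.mul (continuousAt_id.rpow_const (Or.inl (hpos t ht).ne'))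
      (ContinuousAt.rpow_const (by fun_prop) (Or.inr (by linarith)))
  have hc1 := hc α (β + 1) (by linarith)
  have hc2 := hc (α + 1) β hβ
  have h := intervalIntegral.integral_eq_sub_of_hasDerivAt hderiv
    ((hc1.const_mul α).sub (hc2.const_mul β))
  rw [intervalIntegral.integral_sub (hc1.const_mul α) (hc2.const_mul β),
    intervalIntegral.integral_const_mul, intervalIntegral.integral_const_mul,
    sub_self, Real.zero_rpow (by linarith), mul_zero, zero_sub] at h
  have hβ0 : 0 < β := by linarith
  have hG2 := Real.Gamma_pos_of_pos hβ0
  rw [← neg_eq_iff_eq_neg.2 h, betaTail, betaTail, Real.Gamma_add_one hβ0.ne',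
    show α + 1 + β = α + β + 1 by ring, show α + (β + 1) = α + β + 1 by ring]
  rcases hα.eq_or_lt with rfl | hα
  · simp only [Real.Gamma_zero, zero_mul, div_zero, zero_sub, neg_neg, sub_zero, zero_add,
      Real.Gamma_one]
    field_simp
  · have hG1 := Real.Gamma_pos_of_pos hα
    rw [Real.Gamma_add_one hα.ne']
    field_simp
    ring

lemma betaTail_succ_sub_div_one_add {n L x : ℝ} {k : ℕ} (hL : 0 ≤ L) (hn : (k : ℝ) + 1 ≤ n)
    (hx : 0 < x) :
    betaTail (L + (k + 1 : ℕ)) (n + 1 - (k + 1 : ℕ)) (x / (1 + x)) -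
        betaTail (L + k) (n + 1 - k) (x / (1 + x)) =
      Real.Gamma (L + n + 1) / (Real.Gamma (k + L + 1) * Real.Gamma (n + 1 - k)) * x ^ k *
        (x ^ L * (1 + x) ^ (-(n + L))) := by
  have hx1 : 0 < 1 + x := by linarith
  have hu : x / (1 + x) < 1 := by rw [div_lt_one hx1]; linarith
  have h := betaTail_succ_sub (α := L + k) (β := n - k) (by positivity) (by linarith)
    (div_pos hx hx1) hu
  have hu' : 1 - x / (1 + x) = (1 + x)⁻¹ := by field_simp; ring
  have hpow : (x / (1 + x)) ^ (L + k) * (1 - x / (1 + x)) ^ (n - k) =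
      x ^ k * (x ^ L * (1 + x) ^ (-(n + L))) := by
    rw [hu', Real.div_rpow hx.le hx1.le, Real.inv_rpow hx1.le, ← Real.rpow_neg hx1.le,
      div_eq_mul_inv, ← Real.rpow_neg hx1.le, mul_assoc, ← Real.rpow_add hx1,
      Real.rpow_add hx, Real.rpow_natCast]
    ring_nf
  rw [hpow] at h
  rw [mul_assoc]
  convert h using 3 <;> push_cast <;> ring_nf

lemma qS_mul_weight {n L x : ℝ} {N : ℕ} (hL : 0 ≤ L) (hn : (N : ℝ) + 1 ≤ n) (hx : 0 < x) :
    qS n L N x * (x ^ L * (1 + x) ^ (-(n + L))) =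
      betaTail (L + N + 1) (n - N) (x / (1 + x)) - betaTail L (n + 1) (x / (1 + x)) := by
  have h : ∀ k ∈ range (N + 1),
      Real.Gamma (L + n + 1) / (Real.Gamma (k + L + 1) * Real.Gamma (n + 1 - k)) * x ^ k *
        (x ^ L * (1 + x) ^ (-(n + L))) =
      betaTail (L + (k + 1 : ℕ)) (n + 1 - (k + 1 : ℕ)) (x / (1 + x)) -
        betaTail (L + k) (n + 1 - k) (x / (1 + x)) := by
    intro k hk
    have hk : (k : ℝ) ≤ N := by exact_mod_cast Nat.lt_succ_iff.1 (mem_range.1 hk)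
    exact (betaTail_succ_sub_div_one_add hL (by linarith) hx).symm
  rw [qS, sum_mul, sum_congr rfl h,
    sum_range_sub (fun k : ℕ => betaTail (L + k) (n + 1 - k) (x / (1 + x)))]
  push_cast
  ring_nf

lemma qhat_mul_weight {n L x : ℝ} {N : ℕ} (hL : 0 ≤ L) (hn : (N : ℝ) + 1 ≤ n) (hx : 0 < x) :
    qhat n L N x x * (x ^ L * (1 + x) ^ (-(n + L))) =
      betaTail (L + N + 1) (n - N) (x / (1 + x)) - betaTail L (n + 1) (x / (1 + x)) +
        L / (n * x - L) *
          (betaTail (L + 1) n (x / (1 + x)) - betaTail L (n + 1) (x / (1 + x))) := by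
  have hN : (0 : ℝ) ≤ N := N.cast_nonneg
  have h0 := betaTail_succ_sub_div_one_add (n := n) (k := 0) hL (by simp; linarith) hx
  simp only [zero_add, Nat.cast_one, Nat.cast_zero, add_zero, sub_zero, add_sub_cancel_right,
    pow_zero, mul_one] at h0
  have hΓ : L / Real.Gamma (L + 1) = 1 / Real.Gamma L := by
    rcases hL.eq_or_lt with rfl | hL
    · simp [Real.Gamma_zero]
    · have := Real.Gamma_pos_of_pos hL
      rw [Real.Gamma_add_one hL.ne']
      field_simp
  rw [qhat, add_mul, qS_mul_weight hL hn hx, h0]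
  congr 1
  calc _ = 1 / (n * x - L) * (1 / Real.Gamma L) * (Real.Gamma (L + n + 1) / Real.Gamma (n + 1)) *
        (x ^ L * (1 + x) ^ (-(n + L))) := by ring
    _ = _ := by rw [← hΓ]; ring

lemma tendsto_mul_natCast_add {c : ℝ} (hc : 0 < c) (d : ℝ) :
    Tendsto (fun N : ℕ => c * N + d) atTop atTop :=
  tendsto_atTop_add_const_right _ _ (tendsto_natCast_atTop_atTop.const_mul_atTop hc)

lemma tendsto_affine_div_affine (c d : ℝ) {c' : ℝ} (d' : ℝ) (hc' : c' ≠ 0) :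
    Tendsto (fun N : ℕ => (c * N + d) / (c' * N + d')) atTop (nhds (c / c')) := by
  simpa only [add_comm] using tendsto_add_mul_div_add_mul_atTop_nhds d d' c hc'

lemma tendsto_betaTail_affine_zero {c d c' d' v : ℝ} {u : ℕ → ℝ} (hc : 0 ≤ c) (hd : 0 ≤ d)
    (hc' : 0 < c') (hu : Tendsto u atTop (nhds v)) (hv0 : 0 < v) (hv1 : v < 1)
    (h : c / (c + c') < v) :
    Tendsto (fun N : ℕ => betaTail (c * N + d) (c' * N + d') (u N)) atTop (nhds 0) := by
  have e : ∀ N : ℕ, c * N + d + (c' * N + d') = (c + c') * N + (d + d') := fun N => by ring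
  refine tendsto_betaTail_zero (.of_forall fun N => by positivity)
    ((tendsto_mul_natCast_add hc' d').eventually_ge_atTop 1) ?_ ?_ hu hv0 hv1 h
  · simp only [e]
    exact tendsto_mul_natCast_add (by linarith) _
  · simp only [e]
    exact tendsto_affine_div_affine _ _ _ (by linarith)

lemma tendsto_betaTail_affine_one {c d c' d' v : ℝ} {u : ℕ → ℝ} (hc : 0 < c)
    (hc' : 0 < c') (hu : Tendsto u atTop (nhds v)) (hv0 : 0 < v) (hv1 : v < 1)
    (h : v < c / (c + c')) :
    Tendsto (fun N : ℕ => betaTail (c * N + d) (c' * N + d') (u N)) atTop (nhds 1) := by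
  have e : ∀ N : ℕ, c * N + d + (c' * N + d') = (c + c') * N + (d + d') := fun N => by ring
  refine tendsto_betaTail_one ((tendsto_mul_natCast_add hc d).eventually_gt_atTop 0)
    ((tendsto_mul_natCast_add hc' d').eventually_ge_atTop 1) ?_ ?_ hu hv0 hv1 h
  · simp only [e]
    exact tendsto_mul_natCast_add (by linarith) _
  · simp only [e]
    exact tendsto_affine_div_affine _ _ _ (by linarith)

lemma tendsto_qhat_mul_weight {a b y : ℝ} (ha : 0 ≤ a) (hb : 0 < b) (hy : 0 < y)
    (hy1 : a / (b + 1) < y) (hy2 : y < (a + 1) / b) {x : ℕ → ℝ} (hx : Tendsto x atTop (nhds y))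
    (j : ℕ) :
    Tendsto (fun N : ℕ => qhat ((b + 1) * N) (a * N) (N + j) (x N) (x N) *
      (x N ^ (a * N) * (1 + x N) ^ (-((b + 1) * N + a * N)))) atTop (nhds 1) := by
  have hb1 : 0 < b + 1 := by linarith
  have hy' : 0 < 1 + y := by linarith
  rw [div_lt_iff₀ hb1] at hy1
  rw [lt_div_iff₀ hb] at hy2
  have hu : Tendsto (fun N => x N / (1 + x N)) atTop (nhds (y / (1 + y))) :=
    hx.div (hx.const_add 1) hy'.ne'
  have hv0 : 0 < y / (1 + y) := by positivity
  have hv1 : y / (1 + y) < 1 := by rw [div_lt_one hy']; linarith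
  have hlow : a / (a + (b + 1)) < y / (1 + y) := by
    rw [div_lt_div_iff₀ (by linarith) hy']; nlinarith
  have hhigh : y / (1 + y) < (a + 1) / ((a + 1) + b) := by
    rw [div_lt_div_iff₀ hy' (by linarith)]; nlinarith
  have t1 := tendsto_betaTail_affine_one (d := (j : ℝ) + 1) (d' := -(j : ℝ))
    (by linarith) hb hu hv0 hv1 hhigh
  have t2 := tendsto_betaTail_affine_zero (d := 0) (d' := 1) ha le_rfl hb1 hu hv0 hv1 hlow
  have t3 := tendsto_betaTail_affine_zero (d := 1) (d' := 0) ha zero_le_one hb1 hu hv0 hv1 hlow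
  have t4 : Tendsto (fun N : ℕ => a * (N : ℝ) / ((b + 1) * N * x N - a * N)) atTop
      (nhds (a / ((b + 1) * y - a))) := by
    have : Tendsto (fun N : ℕ => a / ((b + 1) * x N - a)) atTop
        (nhds (a / ((b + 1) * y - a))) :=
      tendsto_const_nhds.div ((hx.const_mul _).sub_const _) (by linarith)
    refine this.congr' ?_
    filter_upwards [eventually_gt_atTop 0] with N hN
    have hN : (N : ℝ) ≠ 0 := by positivity
    rw [← mul_div_mul_right _ _ hN]
    congr 1
    ring
  have t := (t1.sub t2).add (t4.mul (t3.sub t2))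
  rw [sub_zero, sub_zero, mul_zero, add_zero] at t
  refine t.congr' ?_
  filter_upwards [hx.eventually_const_lt hy,
    (tendsto_mul_natCast_add hb (-((j : ℝ) + 1))).eventually_ge_atTop 0] with N hN hN'
  rw [qhat_mul_weight (by positivity) (by push_cast; linarith) hN]
  push_cast
  ring_nf

lemma tendsto_ghat_mul_weight {a b y : ℝ} (ha : 0 ≤ a) (hb : 0 < b) (hy : 0 < y)
    (hy1 : a / (b + 1) < y) (hy2 : y < (a + 1) / b) {x : ℕ → ℝ} (hx : Tendsto x atTop (nhds y)) :
    Tendsto (fun N : ℕ => 1 / (N : ℝ) * ghat ((b + 1) * N) (a * N) N (x N) * x N ^ (a * N) *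
      (1 + x N) ^ (-((b + 1) * N + a * N + 1))) atTop (nhds ((a + 1 - b * y) / (1 + y))) := by
  have hy' : 0 < 1 + y := by linarith
  have t0 := tendsto_qhat_mul_weight ha hb hy hy1 hy2 hx 0
  have t1 := tendsto_qhat_mul_weight ha hb hy hy1 hy2 hx 1
  have r1 := tendsto_affine_div_affine (a + 1) 1 0 one_ne_zero
  have r2 := tendsto_affine_div_affine b (-1) 0 one_ne_zero
  have t := ((r1.mul t1).sub ((hx.mul r2).mul t0)).div (hx.const_add 1) hy'.ne'
  rw [show ((a + 1) / 1 * 1 - y * (b / 1) * 1) / (1 + y) = (a + 1 - b * y) / (1 + y) by ring] at t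
  refine t.congr' ?_
  filter_upwards [hx.eventually_const_lt hy] with N hN
  have hN1 : 0 < 1 + x N := by linarith
  rw [Pi.div_apply, neg_add _ (1 : ℝ), Real.rpow_add hN1, Real.rpow_neg_one, ghat]
  simp only [add_zero, one_mul]
  ring

/-- Bulk asymptotics, in the strongly non-unitary regime, of the on-diagonal overlap
prefactor `ĝ_N · ω̂` of the induced spherical unitary ensemble. -/
theorem ghat_bulk_asymptotics (a b : ℝ) (ha : 0 ≤ a) (hb : 0 < b)
    (p : ℝ) (hp : 0 < p) (hp1 : a / (b + 1) < p ^ 2) (hp2 : p ^ 2 < (a + 1) / b)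
    (χ : ℝ) :
    Tendsto (fun N : ℕ =>
      let LN : ℝ := a * N
      let nN : ℝ := (b + 1) * N
      let δN : ℝ := (nN + LN + 1) / (N * (1 + p ^ 2) ^ 2)
      let lamN : ℝ := p + χ / Real.sqrt (N * δN)
      (1 / (N : ℝ)) * ghat nN LN N (lamN ^ 2) * lamN ^ (2 * LN) *
        (1 + lamN ^ 2) ^ (-(nN + LN + 1)))
      atTop
      (nhds ((a + 1 - b * p ^ 2) / (1 + p ^ 2))) := by
  have hp2pos : 0 < p ^ 2 := by positivity
  have hlam : Tendsto (fun N : ℕ => p + χ / Real.sqrt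
      (N * (((b + 1) * N + a * N + 1) / (N * (1 + p ^ 2) ^ 2)))) atTop (nhds p) := by
    have hs : Tendsto (fun N : ℕ => (N : ℝ) *
        (((b + 1) * N + a * N + 1) / (N * (1 + p ^ 2) ^ 2))) atTop atTop := by
      have hc : 0 < ((1 + p ^ 2) ^ 2)⁻¹ := by positivity
      refine ((tendsto_mul_natCast_add (c := b + 1 + a) (by linarith) 1).atTop_mul_const hc).congr'
        ?_
      filter_upwards [eventually_gt_atTop 0] with N hN
      have hN : (N : ℝ) ≠ 0 := by positivity
      field_simp
    simpa using ((Real.tendsto_sqrt_atTop.comp hs).const_div_atTop χ).const_add p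
  refine (tendsto_ghat_mul_weight ha hb hp2pos hp1 hp2 (hlam.pow 2)).congr' ?_
  filter_upwards [hlam.eventually_const_lt hp] with N hN
  dsimp only
  rw [Real.rpow_mul hN.le, Real.rpow_two]
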